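/- arXiv:2409.19195 — 2 statements merged into one kernel-verified Lean document; each statement's English description precedes it below -/
import Mathlib

section
/- Let v = 1000 and w = 0110. Then Win(v,w;p) = 1 − p for all p ∈ (0,1) (so (v,w) has odd symmetry: Win(v,w;1−p) = 1 − Win(v,w;p)), and yet the pair (v,w) does not have property R. -/
open scoped BigOperators

/-- Bernoulli(p) weight of a binary word `u`: `ℙ_p(u) = p^{‖u‖₁} (1-p)^{‖u‖₀}`. -/
noncomputable def wProb (p : ℝ) (u : List Bool) : ℝ :=
  p ^ (u.count true) * (1 - p) ^ (u.count false)

/-- Number of occurrences of `v` as a contiguous subword of `u`. -/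
def occCount (v u : List Bool) : ℕ :=
  (List.range (u.length + 1)).countP (fun i => decide (v <+: u.drop i))

/-- `Ω_{v,w}(v)`: binary words having `v` as a suffix, containing `v` exactly once
as a subword, and not containing `w` as a subword.  (`Ω_{v,w}(w) = OmegaWin w v`.) -/
def OmegaWin (v w : List Bool) : Set (List Bool) :=
  {u | v <:+ u ∧ occCount v u = 1 ∧ ¬ (w <:+: u)}

/-- The win probability `Win(v,w;p) = ∑_{u ∈ Ω_{v,w}(v)} ℙ_p(u)`. -/
noncomputable def Win (v w : List Bool) (p : ℝ) : ℝ :=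
  ∑' u : OmegaWin v w, wProb p u

/-- The correlation polynomial `vw_p = ∑_{u ∈ O(v,w)} ℙ_p(u)⁻¹`, where `O(v,w)` is
the set of nonempty words that are simultaneously a suffix of `v` and a prefix of `w`. -/
noncomputable def corr (v w : List Bool) (p : ℝ) : ℝ :=
  ∑ i ∈ Finset.Icc 1 w.length,
    if w.take i <:+ v then (wProb p (w.take i))⁻¹ else 0

/-- `Ω*_{v,w}(v) = {x : x ++ v ∈ Ω_{v,w}(v)}` (with `x` possibly empty). -/
def OmegaStarV (v w : List Bool) : Set (List Bool) :=
  {x | x ++ v ∈ OmegaWin v w}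

/-- Property `R`: `Ω*_{v,w}(v) = Ω*_{v,w}(w)`. -/
def PropR (v w : List Bool) : Prop :=
  OmegaStarV v w = {x | x ++ w ∈ OmegaWin w v}

/-- `D(v,w)`: nonempty proper prefixes `v₁⋯v_{n-k}` of `v` (`1 ≤ k ≤ n-1`) such that
`w₁⋯w_k = v_{n-k+1}⋯v_n`. -/
def Dset (v w : List Bool) : Set (List Bool) :=
  {x | ∃ k, 1 ≤ k ∧ k ≤ v.length - 1 ∧ k ≤ w.length ∧
    x = v.take (v.length - k) ∧ w.take k = v.drop (v.length - k)}

/-- `F(v,w) = D(v,v) ∪ D(w,w) ∪ D(w,v) ∪ D(v,w)`. -/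
def Fset (v w : List Bool) : Set (List Bool) :=
  Dset v v ∪ Dset w w ∪ Dset w v ∪ Dset v w

/-- `a^m`: concatenation of `m` copies of the word `a`. -/
def wpow (a : List Bool) (m : ℕ) : List Bool :=
  (List.replicate m a).flatten

open scoped ENNReal

theorem occCount_cons (v : List Bool) (b : Bool) (u : List Bool) :
    occCount v (b :: u) = occCount v u + if v <+: b :: u then 1 else 0 := by
  unfold occCount
  rw [List.length_cons, List.range_succ_eq_map, List.countP_cons, List.countP_map]
  simp [Function.comp_def]

theorem occCount_pos_of_suffix {v u : List Bool} (h : v <:+ u) : 0 < occCount v u := by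
  obtain ⟨t, rfl⟩ := h
  refine List.countP_pos_iff.2 ⟨t.length, ?_, ?_⟩ <;> simp

theorem cons_mem_OmegaWin_iff {v w : List Bool} {b : Bool} {u : List Bool} (hne : b :: u ≠ v)
    (hv : ¬ v <+: b :: u) (hw : ¬ w <+: b :: u) :
    b :: u ∈ OmegaWin v w ↔ u ∈ OmegaWin v w := by
  simp only [OmegaWin, Set.mem_ofPred_eq, occCount_cons, if_neg hv, List.suffix_cons_iff,
    List.infix_cons_iff, hne.symm, hw, false_or, add_zero]

/-- A member of `OmegaWin v w` with `v` as a prefix is `v` itself. -/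
theorem eq_of_prefix_of_mem_OmegaWin {v w u : List Bool} (hu : u ∈ OmegaWin v w)
    (hv : v <+: u) : u = v := by
  obtain ⟨hs, ho, -⟩ := hu
  cases u with
  | nil => exact (List.prefix_nil.1 hv).symm
  | cons b u =>
    rcases List.suffix_cons_iff.1 hs with h | h
    · exact h.symm
    · have := occCount_pos_of_suffix h
      rw [occCount_cons, if_pos hv] at ho
      omega

/-- `OmegaWin v w` is a prefix-free code. -/
theorem eq_nil_of_append_mem_OmegaWin {v w : List Bool} (x y : List Bool)
    (hx : x ∈ OmegaWin v w) (hxy : x ++ y ∈ OmegaWin v w) : y = [] := by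
  induction x with
  | nil =>
    obtain rfl := List.suffix_nil.1 hx.1
    simpa using eq_of_prefix_of_mem_OmegaWin hxy List.nil_prefix
  | cons b x ih =>
    by_cases hv : v <+: b :: x
    · have h1 := eq_of_prefix_of_mem_OmegaWin hx hv
      have h2 := eq_of_prefix_of_mem_OmegaWin hxy (hv.trans (List.prefix_append _ _))
      simpa using h2.trans h1.symm
    · have hxv : v <:+ x := by
        rcases List.suffix_cons_iff.1 hx.1 with h | h
        · exact absurd (h ▸ List.prefix_rfl) hv
        · exact h
      have hx' : x ∈ OmegaWin v w :=
        ⟨hxv, by simpa [occCount_cons, hv] using hx.2.1, fun h => hx.2.2 (List.infix_cons h)⟩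
      refine ih hx' ?_
      obtain ⟨h1, h2, h3⟩ := hxy
      rw [List.cons_append] at h1 h2 h3
      have h4 : v <:+ x ++ y := by
        rcases List.suffix_cons_iff.1 h1 with h | h
        · have hl := congrArg List.length h
          have := hxv.length_le
          simp only [List.length_cons, List.length_append] at hl
          omega
        · exact h
      have := occCount_pos_of_suffix h4
      rw [occCount_cons] at h2
      exact ⟨h4, by omega, fun h => h3 (List.infix_cons h)⟩

theorem tsum_list_bool (f : List Bool → ℝ≥0∞) :
    ∑' u, f u = f [] + (∑' u, f (true :: u) + ∑' u, f (false :: u)) := by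
  let e : Unit ⊕ (List Bool ⊕ List Bool) ≃ List Bool :=
    { toFun := Sum.elim (fun _ => []) (Sum.elim (List.cons true) (List.cons false))
      invFun := fun u => match u with
        | [] => Sum.inl ()
        | true :: u => Sum.inr (Sum.inl u)
        | false :: u => Sum.inr (Sum.inr u)
      left_inv := by rintro (_ | _ | _) <;> rfl
      right_inv := by rintro (_ | ⟨_ | _, _⟩) <;> rfl }
  rw [← e.tsum_eq, ENNReal.summable.tsum_sum ENNReal.summable,
    ENNReal.summable.tsum_sum ENNReal.summable]
  simp [e]

theorem ofReal_wProb_cons {p : ℝ} (h0 : 0 ≤ p) (h1 : p ≤ 1) (b : Bool) (u : List Bool) :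
    ENNReal.ofReal (wProb p (b :: u)) =
      ENNReal.ofReal (if b then p else 1 - p) * ENNReal.ofReal (wProb p u) := by
  have h2 : 0 ≤ 1 - p := by linarith
  rw [← ENNReal.ofReal_mul (by split_ifs <;> assumption)]
  congr 1
  cases b <;> simp [wProb] <;> ring

open Classical in
/-- The total weight of the words `y` of length less than `n` for which `x ++ y ∈ S`. -/
noncomputable def truncWeight (S : Set (List Bool)) (p : ℝ) (n : ℕ) (x : List Bool) : ℝ≥0∞ :=
  ∑' y, if y.length < n ∧ x ++ y ∈ S then ENNReal.ofReal (wProb p y) else 0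

open Classical in
/-- The total weight of the words `y` for which `x ++ y ∈ S`. -/
noncomputable def contWeight (S : Set (List Bool)) (p : ℝ) (x : List Bool) : ℝ≥0∞ :=
  ∑' y, if x ++ y ∈ S then ENNReal.ofReal (wProb p y) else 0

open Classical in
theorem truncWeight_succ (S : Set (List Bool)) {p : ℝ} (h0 : 0 ≤ p) (h1 : p ≤ 1) (n : ℕ)
    (x : List Bool) : truncWeight S p (n + 1) x = (if x ∈ S then 1 else 0) +
      (ENNReal.ofReal p * truncWeight S p n (x ++ [true]) +
        ENNReal.ofReal (1 - p) * truncWeight S p n (x ++ [false])) := by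
  unfold truncWeight
  rw [tsum_list_bool]
  have hnil : wProb p [] = 1 := by simp [wProb]
  simp [ofReal_wProb_cons h0 h1, ← ENNReal.tsum_mul_left, hnil]

open Classical in
theorem contWeight_eq (S : Set (List Bool)) {p : ℝ} (h0 : 0 ≤ p) (h1 : p ≤ 1)
    (x : List Bool) : contWeight S p x = (if x ∈ S then 1 else 0) +
      (ENNReal.ofReal p * contWeight S p (x ++ [true]) +
        ENNReal.ofReal (1 - p) * contWeight S p (x ++ [false])) := by
  unfold contWeight
  rw [tsum_list_bool]
  have hnil : wProb p [] = 1 := by simp [wProb]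
  simp [ofReal_wProb_cons h0 h1, ← ENNReal.tsum_mul_left, hnil]

theorem truncWeight_le_one {S : Set (List Bool)}
    (hS : ∀ x y, x ∈ S → x ++ y ∈ S → y = []) {p : ℝ} (h0 : 0 ≤ p) (h1 : p ≤ 1) (n : ℕ)
    (x : List Bool) : truncWeight S p n x ≤ 1 := by
  induction n generalizing x with
  | zero => simp [truncWeight]
  | succ n ih =>
    rw [truncWeight_succ S h0 h1]
    by_cases hx : x ∈ S
    · have key (b : Bool) : truncWeight S p n (x ++ [b]) = 0 := by
        refine ENNReal.tsum_eq_zero.2 fun y => if_neg fun h => ?_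
        have := hS x (b :: y) hx (by simpa using h.2)
        simp at this
      simp [hx, key]
    · rw [if_neg hx, zero_add]
      calc _ ≤ ENNReal.ofReal p * 1 + ENNReal.ofReal (1 - p) * 1 := by gcongr <;> apply ih
        _ = 1 := by
          rw [mul_one, mul_one, ← ENNReal.ofReal_add h0 (by linarith)]
          simp

theorem contWeight_le_one {S : Set (List Bool)}
    (hS : ∀ x y, x ∈ S → x ++ y ∈ S → y = []) {p : ℝ} (h0 : 0 ≤ p) (h1 : p ≤ 1)
    (x : List Bool) : contWeight S p x ≤ 1 := by
  classical
  unfold contWeight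
  rw [ENNReal.tsum_eq_iSup_sum]
  refine iSup_le fun s => ?_
  refine le_trans ?_ (truncWeight_le_one hS h0 h1 (s.sup List.length + 1) x)
  refine le_trans (Finset.sum_le_sum fun y hy => ?_) (ENNReal.sum_le_tsum s)
  have : y.length ≤ s.sup List.length := Finset.le_sup hy
  simp [Nat.lt_succ_of_le this]

theorem Win_eq_contWeight (v w : List Bool) {p : ℝ} (h0 : 0 ≤ p) (h1 : p ≤ 1) :
    Win v w p = (contWeight (OmegaWin v w) p []).toReal := by
  classical
  have hnn (u : List Bool) : 0 ≤ wProb p u :=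
    mul_nonneg (pow_nonneg h0 _) (pow_nonneg (by linarith) _)
  have : contWeight (OmegaWin v w) p [] = ∑' u : OmegaWin v w, ENNReal.ofReal (wProb p u) := by
    rw [tsum_subtype (OmegaWin v w) fun u => ENNReal.ofReal (wProb p u)]
    simp [contWeight, Set.indicator_apply]
  rw [this, ENNReal.tsum_toReal_eq fun _ => ENNReal.ofReal_ne_top]
  simp [Win, hnn]

open Classical in
theorem toReal_contWeight_eq {v w : List Bool} {p : ℝ} (h0 : 0 ≤ p) (h1 : p ≤ 1)
    (x : List Bool) : (contWeight (OmegaWin v w) p x).toReal =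
      (if x ∈ OmegaWin v w then 1 else 0) +
      (p * (contWeight (OmegaWin v w) p (x ++ [true])).toReal +
        (1 - p) * (contWeight (OmegaWin v w) p (x ++ [false])).toReal) := by
  have hfin (y : List Bool) : contWeight (OmegaWin v w) p y ≠ ∞ :=
    ((contWeight_le_one eq_nil_of_append_mem_OmegaWin h0 h1 y).trans_lt ENNReal.one_lt_top).ne
  have hmul (c : ℝ) (y : List Bool) :
      ENNReal.ofReal c * contWeight (OmegaWin v w) p y ≠ ∞ :=
    ENNReal.mul_ne_top ENNReal.ofReal_ne_top (hfin y)
  rw [contWeight_eq _ h0 h1, ENNReal.toReal_add (by split_ifs <;> simp)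
    (ENNReal.add_ne_top.2 ⟨hmul _ _, hmul _ _⟩), ENNReal.toReal_add (hmul _ _) (hmul _ _),
    ENNReal.toReal_mul, ENNReal.toReal_mul, ENNReal.toReal_ofReal h0,
    ENNReal.toReal_ofReal (by linarith)]
  split_ifs <;> simp

theorem contWeight_of_length_lt {v w x : List Bool} {p : ℝ} (h0 : 0 ≤ p) (h1 : p ≤ 1)
    (hx : x.length < v.length) : (contWeight (OmegaWin v w) p x).toReal =
      p * (contWeight (OmegaWin v w) p (x ++ [true])).toReal +
        (1 - p) * (contWeight (OmegaWin v w) p (x ++ [false])).toReal := by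
  classical
  rw [toReal_contWeight_eq h0 h1, if_neg fun h => hx.not_ge h.1.length_le, zero_add]

/-- If neither `v` nor `w` can start a word extending `b :: x`, the first letter may be dropped. -/
theorem contWeight_cons {v w x : List Bool} {b : Bool} (p : ℝ) (hv : v.length ≤ x.length + 1)
    (hw : w.length ≤ x.length + 1) (hv' : ¬ v <+: b :: x) (hw' : ¬ w <+: b :: x) :
    contWeight (OmegaWin v w) p (b :: x) = contWeight (OmegaWin v w) p x := by
  classical
  unfold contWeight
  refine tsum_congr fun y => ?_
  have hpre {t : List Bool} (ht : t.length ≤ x.length + 1) (h : t <+: b :: (x ++ y)) :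
      t <+: b :: x :=
    List.prefix_of_prefix_length_le h (List.prefix_append (b :: x) y) (by simpa using ht)
  rw [List.cons_append, cons_mem_OmegaWin_iff (fun h => hv' (hpre hv (h ▸ List.prefix_rfl)))
    (fun h => hv' (hpre hv h)) fun h => hw' (hpre hw h)]

theorem contWeight_self {v w : List Bool} (p : ℝ) (hv : v ∈ OmegaWin v w) :
    contWeight (OmegaWin v w) p v = 1 := by
  classical
  unfold contWeight
  rw [tsum_eq_single []]
  · simp [hv, wProb]
  · exact fun y hy => if_neg fun h => hy (eq_nil_of_append_mem_OmegaWin v y hv h)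

theorem contWeight_loser (v w : List Bool) (p : ℝ) :
    contWeight (OmegaWin v w) p w = 0 :=
  ENNReal.tsum_eq_zero.2 fun y => if_neg fun h => h.2.2 (List.prefix_append w y).isInfix

theorem Win_1000_0110 {p : ℝ} (hp : p ∈ Set.Ioo (0 : ℝ) 1) :
    Win [true, false, false, false] [false, true, true, false] p = 1 - p := by
  obtain ⟨h0, h1⟩ := hp
  rw [Win_eq_contWeight _ _ h0.le h1.le]
  set v : List Bool := [true, false, false, false] with hv
  set w : List Bool := [false, true, true, false] with hw
  set a : List Bool → ℝ := fun x => (contWeight (OmegaWin v w) p x).toReal with ha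
  have step (x : List Bool) (hx : x.length < 4) :
      a x = p * a (x ++ [true]) + (1 - p) * a (x ++ [false]) :=
    contWeight_of_length_lt h0.le h1.le hx
  have drop (b c d e : Bool) (hvx : ¬ v <+: [b, c, d, e]) (hwx : ¬ w <+: [b, c, d, e]) :
      a [b, c, d, e] = a [c, d, e] :=
    congrArg ENNReal.toReal (contWeight_cons p le_rfl le_rfl hvx hwx)
  have win : a [true, false, false, false] = 1 := by
    have hmem : v ∈ OmegaWin v w := ⟨List.suffix_rfl, by decide, by decide⟩
    simp [ha, ← hv, contWeight_self p hmem]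
  have lose : a [false, true, true, false] = 0 := by
    simp [ha, ← hw, contWeight_loser]
  have e := step [] (by decide)
  have e0 := step [false] (by decide)
  have e1 := step [true] (by decide)
  have e00 := step [false, false] (by decide)
  have e01 := step [false, true] (by decide)
  have e10 := step [true, false] (by decide)
  have e11 := step [true, true] (by decide)
  have e000 := step [false, false, false] (by decide)
  have e001 := step [false, false, true] (by decide)
  have e010 := step [false, true, false] (by decide)
  have e011 := step [false, true, true] (by decide)
  have e100 := step [true, false, false] (by decide)
  have e101 := step [true, false, true] (by decide)
  have e110 := step [true, true, false] (by decide)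
  have e111 := step [true, true, true] (by decide)
  simp only [List.cons_append, List.nil_append] at *
  rw [drop _ _ _ _ (by decide) (by decide),
    drop _ _ _ _ (by decide) (by decide)] at e000 e001 e010 e101 e110 e111
  rw [drop _ _ _ _ (by decide) (by decide), lose] at e011
  rw [drop _ false false true (by decide) (by decide), win] at e100
  have hp' : p ≠ 0 := h0.ne'
  have hq : (1 - p) ≠ 0 := by linarith
  have f001 : a [false, false, true] = a [false, true] := by linarith
  have f101 : a [true, false, true] = a [false, true] := by linarith
  have f000 : a [false, false, false] = a [false, true] :=
    mul_left_cancel₀ hp' (by linear_combination e000 + p * f001)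
  have f0 : a [false] = a [false, true] := by
    rw [e0, e00, f001, f000]; ring
  have f110 : a [true, true, false] = a [true, false] := by linarith
  have f010 : a [false, true, false] = a [true, false] := by linarith
  have f111 : a [true, true, true] = a [true, false] :=
    mul_left_cancel₀ hq (by linear_combination e111 + (1 - p) * f110)
  have f1 : a [true] = a [true, false] := by
    rw [e1, e11, f111, f110]; ring
  rw [e011, f111, f010] at e01
  rw [f101, e100, f001, e01] at e10
  change a [] = 1 - p
  rw [e, f0, f1, e01]
  refine mul_left_cancel₀ hq ?_
  linear_combination e10

/-- For `v = 1000`, `w = 0110`: `Win(v,w;p) = 1 - p` (so the pair has odd symmetry),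
yet property `R` fails. -/
theorem stmt17 :
    (∀ p ∈ Set.Ioo (0:ℝ) 1,
      Win [true, false, false, false] [false, true, true, false] p = 1 - p) ∧
    (∀ p ∈ Set.Ioo (0:ℝ) 1,
      Win [true, false, false, false] [false, true, true, false] (1 - p) =
        1 - Win [true, false, false, false] [false, true, true, false] p) ∧
    ¬ PropR [true, false, false, false] [false, true, true, false] := by
  refine ⟨fun p hp => Win_1000_0110 hp, fun p hp => ?_, fun h => ?_⟩
  · rw [Win_1000_0110 hp, Win_1000_0110 ⟨by linarith [hp.2], by linarith [hp.1]⟩]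
  · have hmem : [true, false, false] ∈
        OmegaStarV [true, false, false, false] [false, true, true, false] :=
      ⟨by decide, by decide, by decide⟩
    rw [show OmegaStarV _ _ = _ from h] at hmem
    exact hmem.2.2 (by decide)
end

section
/- Let v = 100010 and w = 001100. Then Win(v,w;p) = (1 − p(1−p)⁴)/2 for all p ∈ (0,1); in particular, the function p ↦ Win(v,w;p) on (0,1) attains its minimum value uniquely at p = 1/5, and hence is not monotone on (0,1/2). -/
open scoped BigOperators

section Words

variable {v w : List Bool} {p : ℝ}

theorem wProb_append (p : ℝ) (x y : List Bool) : wProb p (x ++ y) = wProb p x * wProb p y := by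
  simp only [wProb, List.count_append, pow_add]
  ring

theorem wProb_cons (p : ℝ) (b : Bool) (x : List Bool) :
    wProb p (b :: x) = wProb p [b] * wProb p x :=
  wProb_append p [b] x

theorem wProb_reverse (p : ℝ) (x : List Bool) : wProb p x.reverse = wProb p x := by
  simp [wProb]

theorem wProb_nonneg (hp : p ∈ Set.Ioo (0 : ℝ) 1) (x : List Bool) : 0 ≤ wProb p x :=
  mul_nonneg (pow_nonneg hp.1.le _) (pow_nonneg (sub_nonneg.2 hp.2.le) _)

theorem wProb_pos (hp : p ∈ Set.Ioo (0 : ℝ) 1) (x : List Bool) : 0 < wProb p x :=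
  mul_pos (pow_pos hp.1 _) (pow_pos (sub_pos.2 hp.2) _)

/-- The binary words of length `n`. -/
def wordsOfLength : ℕ → Finset (List Bool)
  | 0 => {[]}
  | n + 1 => (Finset.univ ×ˢ wordsOfLength n).image fun x : Bool × List Bool => x.1 :: x.2

theorem mem_wordsOfLength {n : ℕ} {r : List Bool} : r ∈ wordsOfLength n ↔ r.length = n := by
  induction n generalizing r with
  | zero => simp [wordsOfLength]
  | succ n ih => cases r <;> simp [wordsOfLength, ih]

theorem sum_wordsOfLength_succ (n : ℕ) (f : List Bool → ℝ) :
    ∑ r ∈ wordsOfLength (n + 1), f r =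
      ∑ r ∈ wordsOfLength n, (f (true :: r) + f (false :: r)) := by
  rw [wordsOfLength, Finset.sum_image fun x _ y _ h => by simpa [Prod.ext_iff] using h]
  simp [Finset.sum_product, Finset.sum_add_distrib]

theorem sum_wordsOfLength_add (k n : ℕ) (f : List Bool → ℝ) :
    ∑ r ∈ wordsOfLength (k + n), f r =
      ∑ l ∈ wordsOfLength k, ∑ r ∈ wordsOfLength n, f (l ++ r) := by
  induction k generalizing f with
  | zero => simp [wordsOfLength]
  | succ k ih =>
    rw [Nat.add_right_comm, sum_wordsOfLength_succ, ih, sum_wordsOfLength_succ]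
    simp [Finset.sum_add_distrib]

theorem sum_wProb_wordsOfLength (p : ℝ) (n : ℕ) : ∑ r ∈ wordsOfLength n, wProb p r = 1 := by
  induction n with
  | zero => simp [wordsOfLength, wProb]
  | succ n ih =>
    rw [sum_wordsOfLength_succ, ← ih]
    refine Finset.sum_congr rfl fun r _ => ?_
    rw [wProb_cons p true, wProb_cons p false, ← add_mul]
    simp [wProb]

theorem occCount_eq_card (v u : List Bool) :
    occCount v u = ((Finset.range (u.length + 1)).filter fun i => v <+: u.drop i).card := by
  rw [occCount, List.countP_eq_length_filter]
  rfl

theorem prefix_drop_append_append (a v c : List Bool) : v <+: (a ++ v ++ c).drop a.length := by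
  simp [List.append_assoc]

/-- A word lies in `Ω_{v,w}(v)` when `v` is a suffix and neither word occurs before the end. -/
theorem append_singleton_mem_OmegaWin (y : List Bool) (b : Bool) :
    y ++ [b] ∈ OmegaWin v w ↔
      v <:+ y ++ [b] ∧ ¬ v <:+: y ∧ ¬ w <:+: y ++ [b] := by
  simp only [OmegaWin, Set.mem_ofPred_eq, and_congr_right_iff]
  rintro ⟨x, hx⟩
  refine and_congr_left fun _ => ?_
  have hlen : x.length + v.length = y.length + 1 := by
    simpa using congrArg List.length hx
  rw [occCount_eq_card, Finset.card_eq_one]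
  constructor
  · rintro ⟨i, hi⟩ ⟨a, c, hac⟩
    have hmem : ∀ j, j < y.length + 2 → v <+: (y ++ [b]).drop j → j = i := fun j hj hv => by
      rw [← Finset.mem_singleton, ← hi]
      simp only [Finset.mem_filter, Finset.mem_range, List.length_append, List.length_singleton]
      exact ⟨hj, hv⟩
    have hlen' : a.length + v.length + c.length = y.length := by
      simpa [Nat.add_assoc] using congrArg List.length hac
    have h₁ := hmem x.length (by omega) (by
      have h := prefix_drop_append_append x v []
      rwa [List.append_nil, hx] at h)
    have h₂ := hmem a.length (by omega) (by
      have h := prefix_drop_append_append a v (c ++ [b])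
      rwa [← List.append_assoc, hac] at h)
    omega
  · intro hv
    refine ⟨x.length, ?_⟩
    ext i
    simp only [Finset.mem_filter, Finset.mem_range, List.length_append, List.length_singleton,
      Finset.mem_singleton]
    constructor
    · rintro ⟨hi, c, hc⟩
      by_contra hne
      have hl : v.length + c.length = y.length + 1 - i := by
        simpa using congrArg List.length hc
      rcases List.eq_nil_or_concat c with rfl | ⟨c, d, rfl⟩
      · simp only [List.length_nil] at hl
        omega
      · refine hv ⟨y.take i, c, ?_⟩
        have hi' : i ≤ y.length := by
          simp only [List.concat_eq_append, List.length_append,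
            List.length_singleton] at hl
          omega
        rw [List.drop_append_of_le_length hi', List.concat_eq_append, ← List.append_assoc] at hc
        rw [List.append_assoc, (List.append_inj' hc rfl).1, List.take_append_drop]
    · rintro rfl
      refine ⟨by omega, ?_⟩
      have h := prefix_drop_append_append x v []
      rwa [List.append_nil, hx] at h

/-- Reversals of the words containing neither `v` nor `w`. -/
def avoidRev (v w : List Bool) : Set (List Bool) :=
  {r | ¬ v.reverse <:+: r ∧ ¬ w.reverse <:+: r}

/-- Reversals of the words in `Ω_{v,w}(v)`. -/
def winRev (v w : List Bool) : Set (List Bool) :=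
  {r | r.reverse ∈ OmegaWin v w}

theorem cons_mem_avoidRev {b : Bool} {r : List Bool} :
    b :: r ∈ avoidRev v w ↔
      ¬ v.reverse <+: b :: r ∧ ¬ w.reverse <+: b :: r ∧ r ∈ avoidRev v w := by
  simp only [avoidRev, Set.mem_ofPred_eq, List.infix_cons_iff]
  tauto

theorem mem_avoidRev_of_append {l r : List Bool} (h : l ++ r ∈ avoidRev v w) :
    r ∈ avoidRev v w :=
  ⟨fun hv => h.1 (hv.trans (List.suffix_append l r).isInfix),
    fun hw => h.2 (hw.trans (List.suffix_append l r).isInfix)⟩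

theorem cons_mem_winRev {b : Bool} {r : List Bool} :
    b :: r ∈ winRev v w ↔
      v.reverse <+: b :: r ∧ ¬ w.reverse <+: b :: r ∧ r ∈ avoidRev v w := by
  have hrev : ∀ x y : List Bool, x <:+: y.reverse ↔ x.reverse <:+: y := fun x y =>
    ⟨fun h => by simpa using List.IsInfix.reverse h,
      fun h => by simpa using List.IsInfix.reverse h⟩
  have hsuf : v <:+ (b :: r).reverse ↔ v.reverse <+: b :: r := by
    rw [← List.reverse_suffix, List.reverse_reverse]
  rw [winRev, Set.mem_ofPred_eq, List.reverse_cons, append_singleton_mem_OmegaWin,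
    ← List.reverse_cons, hsuf, hrev, hrev, List.infix_cons_iff, avoidRev, Set.mem_ofPred_eq]
  tauto

end Words

section Potential

open Filter Topology

variable {v w : List Bool} {p : ℝ}

/-- The probability that a random word of length `n` contains neither `v` nor `w`. -/
noncomputable def avoidProb (v w : List Bool) (p : ℝ) (n : ℕ) : ℝ :=
  ∑ r ∈ wordsOfLength n, (avoidRev v w).indicator (wProb p) r

theorem avoidProb_nonneg (hp : p ∈ Set.Ioo (0 : ℝ) 1) (n : ℕ) : 0 ≤ avoidProb v w p n :=
  Finset.sum_nonneg fun r _ => Set.indicator_nonneg (fun x _ => wProb_nonneg hp x) r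

theorem avoidProb_add_le (hp : p ∈ Set.Ioo (0 : ℝ) 1) (n : ℕ) :
    avoidProb v w p (v.length + n) ≤ (1 - wProb p v) * avoidProb v w p n := by
  have hmem : v.reverse ∈ wordsOfLength v.length := mem_wordsOfLength.2 (List.length_reverse ..)
  rw [avoidProb, sum_wordsOfLength_add, ← Finset.add_sum_erase _ _ hmem,
    ← sum_wProb_wordsOfLength p v.length, ← Finset.add_sum_erase _ _ hmem, wProb_reverse,
    add_sub_cancel_left, Finset.sum_mul, Finset.sum_eq_zero, zero_add]
  · refine Finset.sum_le_sum fun l _ => ?_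
    rw [avoidProb, Finset.mul_sum]
    refine Finset.sum_le_sum fun r _ => ?_
    by_cases h : l ++ r ∈ avoidRev v w
    · rw [Set.indicator_of_mem h, Set.indicator_of_mem (mem_avoidRev_of_append h), wProb_append]
    · rw [Set.indicator_of_notMem h]
      exact mul_nonneg (wProb_nonneg hp l)
        (Set.indicator_nonneg (fun x _ => wProb_nonneg hp x) r)
  · refine fun r _ => Set.indicator_of_notMem (fun h => h.1 ?_) _
    exact (List.prefix_append _ _).isInfix

theorem tendsto_avoidProb (hp : p ∈ Set.Ioo (0 : ℝ) 1) :
    Tendsto (fun k => avoidProb v w p (v.length * k)) atTop (𝓝 0) := by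
  have hle : wProb p v ≤ 1 := by
    rw [← sum_wProb_wordsOfLength p v.length]
    exact Finset.single_le_sum (fun r _ => wProb_nonneg hp r) (mem_wordsOfLength.2 rfl)
  have hpow : ∀ k, avoidProb v w p (v.length * k) ≤
      (1 - wProb p v) ^ k * avoidProb v w p 0 := fun k => by
    induction k with
    | zero => simp
    | succ k ih =>
      rw [Nat.mul_succ, Nat.add_comm, pow_succ', mul_assoc]
      exact (avoidProb_add_le hp _).trans (mul_le_mul_of_nonneg_left ih (sub_nonneg.2 hle))
  refine squeeze_zero (fun k => avoidProb_nonneg hp _) hpow ?_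
  rw [← zero_mul (avoidProb v w p 0)]
  exact (tendsto_pow_atTop_nhds_zero_of_lt_one (sub_nonneg.2 hle)
    (sub_lt_self 1 (wProb_pos hp v))).mul_const _

/-- A bounded function of the reversed past that is harmonic until absorption, equal to `1` when
`v` is completed and to `0` when `w` is completed, computes the win probability. -/
theorem Win_eq_of_harmonic (hv : v ≠ []) (hw : w ≠ []) (hp : p ∈ Set.Ioo (0 : ℝ) 1)
    {h : List Bool → ℝ} {C : ℝ} (hC : ∀ r, |h r| ≤ C)
    (hone : ∀ r, v.reverse <+: r → h r = 1) (hzero : ∀ r, w.reverse <+: r → h r = 0)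
    (hharm : ∀ r, ¬ v.reverse <+: r → ¬ w.reverse <+: r →
      h r = p * h (true :: r) + (1 - p) * h (false :: r)) :
    Win v w p = h [] := by
  set f : List Bool → ℝ := (winRev v w).indicator (wProb p) with hf
  set g : List Bool → ℝ := (avoidRev v w).indicator fun r => wProb p r * h r with hg
  have hf0 : ∀ r, 0 ≤ f r := Set.indicator_nonneg fun x _ => wProb_nonneg hp x
  have hfnil : f [] = 0 := Set.indicator_of_notMem (fun hm => hv (by
    have h' : v <:+ [] := hm.1
    simpa using h')) _
  have hgnil : g [] = h [] := by
    rw [hg, Set.indicator_of_mem]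
    · simp [wProb]
    · simp [avoidRev, hv, hw]
  have hstep : ∀ r ∈ avoidRev v w, ∀ b,
      f (b :: r) + g (b :: r) = wProb p (b :: r) * h (b :: r) := by
    intro r hr b
    by_cases h₂ : w.reverse <+: b :: r
    · rw [hf, hg, Set.indicator_of_notMem, Set.indicator_of_notMem, hzero _ h₂]
      · simp
      · rw [cons_mem_avoidRev]; tauto
      · rw [cons_mem_winRev]; tauto
    by_cases h₁ : v.reverse <+: b :: r
    · rw [hf, hg, Set.indicator_of_mem, Set.indicator_of_notMem, hone _ h₁]
      · simp
      · rw [cons_mem_avoidRev]; tauto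
      · rw [cons_mem_winRev]; tauto
    · rw [hf, hg, Set.indicator_of_notMem, Set.indicator_of_mem]
      · simp
      · rw [cons_mem_avoidRev]; tauto
      · rw [cons_mem_winRev]; tauto
  have hsum : ∀ r, f (true :: r) + f (false :: r) + (g (true :: r) + g (false :: r)) = g r := by
    intro r
    by_cases hr : r ∈ avoidRev v w
    · have hr' : h r = _ := hharm r (fun hp => hr.1 hp.isInfix) fun hp => hr.2 hp.isInfix
      have ht : wProb p [true] = p := by simp [wProb]
      have hf' : wProb p [false] = 1 - p := by simp [wProb]
      have h₁ := hstep r hr true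
      have h₂ := hstep r hr false
      rw [wProb_cons, ht] at h₁
      rw [wProb_cons, hf'] at h₂
      have h₃ : g r = wProb p r * h r := Set.indicator_of_mem hr _
      rw [h₃, hr']
      linear_combination h₁ + h₂
    · rw [hf, hg]
      simp [Set.indicator, cons_mem_avoidRev, cons_mem_winRev, hr]
  have hpartial : ∀ n, ∑ k ∈ Finset.range (n + 1), ∑ r ∈ wordsOfLength k, f r =
      h [] - ∑ r ∈ wordsOfLength n, g r := fun n => by
    induction n with
    | zero => simp [wordsOfLength, hfnil, hgnil]
    | succ n ih =>
      rw [Finset.sum_range_succ, ih, sum_wordsOfLength_succ, sum_wordsOfLength_succ,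
        ← Finset.sum_congr rfl fun r _ => hsum r, Finset.sum_add_distrib]
      ring
  have hgle : ∀ n, |∑ r ∈ wordsOfLength n, g r| ≤ C * avoidProb v w p n := fun n => by
    rw [avoidProb, Finset.mul_sum]
    refine (Finset.abs_sum_le_sum_abs _ _).trans (Finset.sum_le_sum fun r _ => ?_)
    by_cases hr : r ∈ avoidRev v w
    · rw [hg, Set.indicator_of_mem hr, Set.indicator_of_mem hr, abs_mul,
        abs_of_nonneg (wProb_nonneg hp r), mul_comm]
      exact mul_le_mul_of_nonneg_right (hC r) (wProb_nonneg hp r)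
    · simp [hg, hr]
  have hC0 : 0 ≤ C := (abs_nonneg _).trans (hC [])
  have havoid : ∀ n, avoidProb v w p n ≤ 1 := fun n => by
    rw [← sum_wProb_wordsOfLength p n]
    exact Finset.sum_le_sum fun r _ => Set.indicator_le_self' (fun x _ => wProb_nonneg hp x) r
  set U : ℕ → Finset (List Bool) := fun n => (Finset.range (n + 1)).biUnion wordsOfLength with hU
  have hmemU : ∀ n r, r ∈ U n ↔ r.length ≤ n := fun n r => by
    simp [hU, mem_wordsOfLength]
  have hsumU : ∀ n, ∑ r ∈ U n, f r = h [] - ∑ r ∈ wordsOfLength n, g r := fun n => by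
    rw [← hpartial, hU, Finset.sum_biUnion]
    intro i _ j _ hij
    refine Finset.disjoint_left.2 fun r hi hj => hij ?_
    rw [← mem_wordsOfLength.1 hi, mem_wordsOfLength.1 hj]
  have hsummable : Summable f := by
    refine summable_of_sum_le (c := |h []| + C) hf0 fun s => ?_
    have hs : s ⊆ U (s.sup List.length) := fun r hr =>
      (hmemU _ _).2 (Finset.le_sup (f := List.length) hr)
    refine (Finset.sum_le_sum_of_subset_of_nonneg hs fun r _ _ => hf0 r).trans ?_
    rw [hsumU]
    have h₁ := neg_abs_le (∑ r ∈ wordsOfLength (s.sup List.length), g r)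
    have h₂ := hgle (s.sup List.length)
    have h₃ := mul_le_mul_of_nonneg_left (havoid (s.sup List.length)) hC0
    linarith [le_abs_self (h [])]
  have htU : Tendsto (fun k => U (v.length * k)) atTop atTop := by
    refine tendsto_atTop_finset_of_monotone (fun m n hmn r hr => ?_) fun r => ⟨r.length, ?_⟩
    · exact (hmemU _ _).2 (((hmemU _ _).1 hr).trans (Nat.mul_le_mul_left _ hmn))
    · exact (hmemU _ _).2 (Nat.le_mul_of_pos_left _ (List.length_pos_iff.2 hv))
  have hlim : Tendsto (fun k => ∑ r ∈ U (v.length * k), f r) atTop (𝓝 (h [])) := by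
    simp only [hsumU]
    have h0 : Tendsto (fun k => ∑ r ∈ wordsOfLength (v.length * k), g r) atTop (𝓝 0) := by
      refine squeeze_zero_norm (fun k => hgle _) ?_
      simpa using (tendsto_avoidProb (v := v) (w := w) hp).const_mul C
    simpa using h0.const_sub (h [])
  have htsum : ∑' r, f r = h [] := tendsto_nhds_unique (hsummable.hasSum.comp htU) hlim
  rw [← htsum, Win, tsum_subtype (OmegaWin v w) (wProb p),
    ← (List.reverse_involutive.toPerm (List.reverse (α := Bool))).tsum_eq]
  refine tsum_congr fun r => ?_
  by_cases hr : r ∈ winRev v w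
  · rw [hf, Set.indicator_of_mem hr]
    exact (Set.indicator_of_mem (s := OmegaWin v w) hr _).trans (wProb_reverse p r)
  · rw [hf, Set.indicator_of_notMem hr]
    exact Set.indicator_of_notMem (s := OmegaWin v w) hr _

end Potential

/-- The probability that `100010` occurs before `001100`, given the reversal of the letters read
so far. -/
noncomputable def winPotential (p : ℝ) : List Bool → ℝ
  | false :: true :: false :: false :: false :: true :: _ => 1
  | false :: false :: true :: true :: false :: false :: _ => 0
  | true :: false :: false :: false :: true :: _ => 1 - p + p ^ 2 - p ^ 3 / 2
  | false :: true :: true :: false :: false :: _ => p / 2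
  | false :: false :: false :: true :: _ => (1 + p ^ 2 - p ^ 3) / 2
  | true :: true :: false :: false :: _ => p - p ^ 2 / 2
  | false :: false :: true :: _ => 1 / 2
  | true :: false :: false :: _ => (1 - p + 2 * p ^ 2 - p ^ 3) / 2
  | false :: true :: _ => 1 / 2
  | false :: false :: _ => (1 - p + 2 * p ^ 2 - p ^ 3) / 2
  | true :: _ => 1 / 2
  | [false] => (1 - p + 3 * p ^ 2 - 3 * p ^ 3 + p ^ 4) / 2
  | [] => (1 - p * (1 - p) ^ 4) / 2

theorem abs_winPotential_le {p : ℝ} (hp : p ∈ Set.Ioo (0 : ℝ) 1) (r : List Bool) :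
    |winPotential p r| ≤ 10 := by
  have h0 : ∀ n : ℕ, 0 ≤ p ^ n := fun n => pow_nonneg hp.1.le n
  have h1 : ∀ n : ℕ, p ^ n ≤ 1 := fun n => pow_le_one₀ hp.1.le hp.2.le
  have hp1 := hp.1
  have hp2 := hp.2
  unfold winPotential
  split <;> rw [abs_le] <;> constructor <;>
    nlinarith [h0 2, h0 3, h0 4, h0 5, h1 2, h1 3, h1 4, h1 5]

theorem winPotential_harmonic (p : ℝ) (r : List Bool)
    (hv : ¬ [false, true, false, false, false, true] <+: r)
    (hw : ¬ [false, false, true, true, false, false] <+: r) :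
    winPotential p r =
      p * winPotential p (true :: r) + (1 - p) * winPotential p (false :: r) := by
  rcases r with _ | ⟨_ | _, _ | ⟨_ | _, _ | ⟨_ | _, _ | ⟨_ | _, _ | ⟨_ | _, _ | ⟨_ | _, r⟩⟩⟩⟩⟩⟩ <;>
    first
    | exact absurd ⟨_, rfl⟩ hv
    | exact absurd ⟨_, rfl⟩ hw
    | (simp only [winPotential]; ring)

theorem Win_eq {p : ℝ} (hp : p ∈ Set.Ioo (0 : ℝ) 1) :
    Win [true, false, false, false, true, false] [false, false, true, true, false, false] p
      = (1 - p * (1 - p) ^ 4) / 2 := by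
  rw [Win_eq_of_harmonic (h := winPotential p) (by simp) (by simp) hp (abs_winPotential_le hp)]
  · rfl
  · rintro r ⟨t, rfl⟩
    rfl
  · rintro r ⟨t, rfl⟩
    rfl
  · exact winPotential_harmonic p

theorem mul_one_sub_pow_four_eq (p : ℝ) :
    p * (1 - p) ^ 4 = 256 / 3125 -
      (p - 1 / 5) ^ 2 * (256 / 125 - 113 / 25 * p + 18 / 5 * p ^ 2 - p ^ 3) := by
  ring

theorem cofactor_pos {p : ℝ} (hp : p < 1) :
    0 < 256 / 125 - 113 / 25 * p + 18 / 5 * p ^ 2 - p ^ 3 := by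
  nlinarith [mul_nonneg (sub_nonneg.2 hp.le) (sq_nonneg (p - 13 / 10))]

/-- For `v = 100010`, `w = 001100`: `Win(v,w;p) = (1 - p(1-p)^4)/2`, with unique minimum
at `p = 1/5`; hence `Win` is not monotone on `(0,1/2)`. -/
theorem stmt18 :
    (∀ p ∈ Set.Ioo (0:ℝ) 1,
      Win [true, false, false, false, true, false] [false, false, true, true, false, false] p
        = (1 - p * (1 - p) ^ 4) / 2) ∧
    (∀ p ∈ Set.Ioo (0:ℝ) 1,
      Win [true, false, false, false, true, false] [false, false, true, true, false, false] (1/5)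
        ≤ Win [true, false, false, false, true, false] [false, false, true, true, false, false] p
      ∧ (Win [true, false, false, false, true, false] [false, false, true, true, false, false] p
          = Win [true, false, false, false, true, false] [false, false, true, true, false, false] (1/5)
        → p = 1/5)) ∧
    ¬ MonotoneOn
      (Win [true, false, false, false, true, false] [false, false, true, true, false, false])
      (Set.Ioo (0:ℝ) (1/2)) ∧
    ¬ AntitoneOn
      (Win [true, false, false, false, true, false] [false, false, true, true, false, false])
      (Set.Ioo (0:ℝ) (1/2)) := by
  have hfifth : (1 / 5 : ℝ) ∈ Set.Ioo (0 : ℝ) 1 := by norm_num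
  have hmin : ∀ p ∈ Set.Ioo (0 : ℝ) 1,
      Win [true, false, false, false, true, false] [false, false, true, true, false, false] p
        ≤ Win [true, false, false, false, true, false] [false, false, true, true, false, false]
          (1 / 5) → p = 1 / 5 := by
    intro p hp hle
    rw [Win_eq hp, Win_eq hfifth, mul_one_sub_pow_four_eq] at hle
    have hsq : (p - 1 / 5) ^ 2 ≤ 0 :=
      nonpos_of_mul_nonpos_left (by linarith) (cofactor_pos hp.2)
    exact sub_eq_zero.1 (pow_eq_zero_iff two_ne_zero |>.1 (le_antisymm hsq (sq_nonneg _)))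
  refine ⟨fun p hp => Win_eq hp, fun p hp => ⟨?_, fun h => hmin p hp h.le⟩, fun hmono => ?_,
    fun hanti => ?_⟩
  · rcases le_total (Win [true, false, false, false, true, false]
      [false, false, true, true, false, false] p) (Win [true, false, false, false, true, false]
      [false, false, true, true, false, false] (1 / 5)) with h | h
    · rw [hmin p hp h]
    · exact h
  · have h := hmin (1 / 10) (by norm_num)
      (hmono (by norm_num) (by norm_num) (by norm_num : (1 / 10 : ℝ) ≤ 1 / 5))
    norm_num at h
  · have h := hmin (1 / 4) (by norm_num)
      (hanti (by norm_num) (by norm_num) (by norm_num : (1 / 5 : ℝ) ≤ 1 / 4))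
    norm_num at h
end
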